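/- Let ν ∈ ℂ, l ∈ ℕ₀, and x ∈ (-1,1). Then (1/Γ(ν - l/2 + 1)) · P_ν^{-l/2}(x) = 2^{-l/2} (1-x)^{l/2} · l! · (1/Γ(ν + l/2 + 1)) · ∑_{n=0}^l ((-1)^n (-ν)_n / (n! (l-n)!)) · ((1+x)/(1-x))^{n/2} · P_{ν-l/2}^{l/2-n}(x). -/

import Mathlib

noncomputable def pochC (a : ℂ) (n : ℕ) : ℂ := (ascPochhammer ℂ n).eval a

/-- Ferrers function of the first kind `P_ν^μ(x)`. -/
noncomputable def ferrersP (ν μ : ℂ) (x : ℝ) : ℂ :=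
  (((1 + x) / (1 - x) : ℝ) : ℂ) ^ (μ / 2) *
    ∑' n : ℕ, pochC (-ν) n * pochC (ν + 1) n /
        (Complex.Gamma ((n : ℂ) + 1 - μ) * (n.factorial : ℂ)) *
      (((1 - x) / 2 : ℝ) : ℂ) ^ n

open Filter Topology Finset

theorem pochC_zero (a : ℂ) : pochC a 0 = 1 := by simp [pochC]

theorem pochC_succ (a : ℂ) (n : ℕ) : pochC a (n + 1) = pochC a n * (a + n) :=
  ascPochhammer_succ_eval n a

theorem pochC_succ_left (a : ℂ) (n : ℕ) : pochC a (n + 1) = a * pochC (a + 1) n := by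
  simp [pochC, ascPochhammer_succ_left]

theorem pochC_add (a : ℂ) (n m : ℕ) : pochC a (n + m) = pochC a n * pochC (a + n) m := by
  induction m with
  | zero => simp [pochC_zero]
  | succ m ih =>
    rw [← add_assoc, pochC_succ, pochC_succ, ih]
    push_cast
    ring

theorem inv_Gamma_eq_pochC_mul (a : ℂ) (n : ℕ) :
    (Complex.Gamma a)⁻¹ = pochC a n * (Complex.Gamma (a + n))⁻¹ := by
  induction n with
  | zero => simp [pochC_zero]
  | succ n ih =>
    rw [ih, Complex.one_div_Gamma_eq_self_mul_one_div_Gamma_add_one (a + n), pochC_succ]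
    push_cast
    ring_nf

/-- Coefficients of the regularized Gauss hypergeometric series. -/
noncomputable def regHypCoeff (a b c : ℂ) (n : ℕ) : ℂ :=
  pochC a n * pochC b n / (Complex.Gamma (c + n) * (n.factorial : ℂ))

/-- The regularized Gauss hypergeometric series. -/
noncomputable def regHyp (a b c t : ℂ) : ℂ := ∑' n : ℕ, regHypCoeff a b c n * t ^ n

theorem regHypCoeff_succ (a b c : ℂ) (n : ℕ) :
    ((n : ℂ) + 1) * (c + n) * regHypCoeff a b c (n + 1) =
      (a + n) * (b + n) * regHypCoeff a b c n := by
  have hG := Complex.one_div_Gamma_eq_self_mul_one_div_Gamma_add_one (c + n)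
  have hn : (n : ℂ) + 1 ≠ 0 := Nat.cast_add_one_ne_zero n
  simp only [regHypCoeff, pochC_succ, Nat.factorial_succ, div_eq_mul_inv, mul_inv, hG]
  push_cast
  rw [← add_assoc c]
  field_simp

theorem summable_regHypCoeff (a b c : ℂ) {t : ℂ} (ht : ‖t‖ < 1) :
    Summable fun n => regHypCoeff a b c n * t ^ n := by
  obtain ⟨r, hr, hr1⟩ := exists_between ht
  have h1 := (tendsto_add_mul_div_add_mul_atTop_nhds (𝕜 := ℂ) a 1 1 one_ne_zero).mul
    (tendsto_add_mul_div_add_mul_atTop_nhds (𝕜 := ℂ) b c 1 one_ne_zero)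
  have h2 := (h1.mul_const t).norm
  have h3 : ∀ᶠ n : ℕ in atTop, c + n ≠ 0 := by
    obtain ⟨N, hN⟩ := exists_nat_gt ‖c‖
    filter_upwards [eventually_ge_atTop N] with n hn h
    have h4 : ‖c‖ = n := by
      rw [eq_neg_of_add_eq_zero_left h]
      simp
    have h5 : (N : ℝ) ≤ n := by exact_mod_cast hn
    linarith
  refine summable_of_ratio_norm_eventually_le hr1 ?_
  filter_upwards [h2.eventually_lt_const (u := r) (by simpa using hr), h3] with n hn hc
  have hn1 : (1 : ℂ) + n ≠ 0 := by
    rw [add_comm]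
    exact Nat.cast_add_one_ne_zero n
  have key : regHypCoeff a b c (n + 1) * t ^ (n + 1) =
      ((a + 1 * n) / (1 + 1 * n) * ((b + 1 * n) / (c + 1 * n)) * t) *
        (regHypCoeff a b c n * t ^ n) := by
    have := regHypCoeff_succ a b c n
    simp only [one_mul]
    field_simp
    rw [pow_succ]
    linear_combination t ^ n * t * this
  rw [key, norm_mul]
  exact mul_le_mul_of_nonneg_right hn.le (norm_nonneg _)

theorem hasSum_one_sub_cpow_neg (s : ℂ) {t : ℂ} (ht : ‖t‖ < 1) :
    HasSum (fun n : ℕ => pochC s n / (n.factorial : ℂ) * t ^ n) (1 / (1 - t) ^ s) := by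
  have h := (Complex.one_div_one_sub_cpow_hasFPowerSeriesOnBall_zero s).hasSum (y := t)
    (by simpa [← ofReal_norm] using ht)
  convert! h using 1
  · ext n
    have hf : (n.factorial : ℂ) ≠ 0 := by exact_mod_cast n.factorial_ne_zero
    have := Ring.factorial_nsmul_multichoose_eq_ascPochhammer s n
    rw [Polynomial.ascPochhammer_smeval_eq_eval, Ring.multichoose_eq, nsmul_eq_mul] at this
    simp [pochC, ← this]
    field_simp
  · simp

/-- The Pfaff–Saalschütz convolution identity, in recursive form. -/
theorem saalschutz_succ (a b c : ℂ) (n : ℕ) (h : ℕ → ℂ)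
    (hh : ∀ n, h n = ∑ j ∈ range (n + 1), regHypCoeff a b c j *
      (pochC (c - a - b) (n - j) / ((n - j).factorial : ℂ))) :
    ((n : ℂ) + 1) * (c + n) * h (n + 1) = (c - a + n) * (c - b + n) * h n := by
  set s := c - a - b with hs
  have hpt : ∀ j ∈ range (n + 1),
      ((n : ℂ) + 1) * (c + n) * (regHypCoeff a b c j *
        (pochC s (n + 1 - j) / ((n + 1 - j).factorial : ℂ))) -
      (c - a + n) * (c - b + n) * (regHypCoeff a b c j *
        (pochC s (n - j) / ((n - j).factorial : ℂ))) =
      (j : ℂ) * (c + j - 1) * regHypCoeff a b c j *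
        (pochC s (n + 1 - j) / ((n + 1 - j).factorial : ℂ)) -
      ((j + 1 : ℕ) : ℂ) * (c + (j + 1 : ℕ) - 1) * regHypCoeff a b c (j + 1) *
        (pochC s (n + 1 - (j + 1)) / ((n + 1 - (j + 1)).factorial : ℂ)) := by
    intro j hj
    obtain ⟨m, rfl⟩ := Nat.exists_eq_add_of_le (Nat.lt_succ_iff.mp (mem_range.mp hj))
    have e1 : j + m + 1 - j = m + 1 := by omega
    have e2 : j + m - j = m := by omega
    have e3 : j + m + 1 - (j + 1) = m := by omega
    have hf : (m.factorial : ℂ) ≠ 0 := by exact_mod_cast m.factorial_ne_zero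
    have hm : (m : ℂ) + 1 ≠ 0 := Nat.cast_add_one_ne_zero m
    have hr := regHypCoeff_succ a b c j
    rw [e1, e2, e3, pochC_succ, Nat.factorial_succ]
    have hr' : ((j + 1 : ℕ) : ℂ) * (c + (j + 1 : ℕ) - 1) * regHypCoeff a b c (j + 1) =
        (a + j) * (b + j) * regHypCoeff a b c j := by
      rw [← hr]
      push_cast
      ring
    rw [hr', hs]
    push_cast
    field_simp
    ring
  have hsum := sum_congr rfl hpt
  rw [sum_range_sub', sum_sub_distrib, ← mul_sum, ← mul_sum, ← hh n] at hsum
  rw [hh (n + 1), sum_range_succ, mul_add]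
  simp only [Nat.sub_self, pochC_zero, Nat.factorial_zero] at hsum ⊢
  push_cast at hsum ⊢
  linear_combination hsum

theorem sum_regHypCoeff_mul_pochC (a b c : ℂ) (hc : ∀ n : ℕ, c + n ≠ 0) (n : ℕ) :
    ∑ j ∈ range (n + 1), regHypCoeff a b c j *
      (pochC (c - a - b) (n - j) / ((n - j).factorial : ℂ)) =
      regHypCoeff (c - a) (c - b) c n := by
  induction n with
  | zero => simp [regHypCoeff, pochC_zero]
  | succ n ih =>
    have hn : ((n : ℂ) + 1) * (c + n) ≠ 0 := mul_ne_zero (Nat.cast_add_one_ne_zero n) (hc n)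
    apply mul_left_cancel₀ hn
    rw [saalschutz_succ a b c n _ fun _ => rfl, ih, regHypCoeff_succ]

/-- Euler's transformation of the Gauss hypergeometric series. -/
theorem regHyp_euler (a b c : ℂ) (hc : ∀ n : ℕ, c + n ≠ 0) {t : ℂ} (ht : ‖t‖ < 1) :
    regHyp a b c t * (1 / (1 - t) ^ (c - a - b)) = regHyp (c - a) (c - b) c t := by
  have hS := hasSum_one_sub_cpow_neg (c - a - b) ht
  rw [← hS.tsum_eq, regHyp, tsum_mul_tsum_eq_tsum_sum_range_of_summable_norm
    (summable_regHypCoeff a b c ht).norm hS.summable.norm, regHyp]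
  refine tsum_congr fun n => ?_
  rw [← sum_regHypCoeff_mul_pochC a b c hc n, sum_mul]
  refine sum_congr rfl fun j hj => ?_
  rw [← pow_mul_pow_sub t (Nat.lt_succ_iff.mp (mem_range.mp hj))]
  ring

/-- A form of the Chu–Vandermonde identity. -/
theorem sum_choose_mul_pochC_mul_inv_Gamma (b c : ℂ) (l : ℕ) :
    ∑ n ∈ range (l + 1), (l.choose n : ℂ) *
      ((-1) ^ n * pochC (c - b) n * (Complex.Gamma (c + n))⁻¹) =
      pochC b l * (Complex.Gamma (c + l))⁻¹ := by
  induction l generalizing b c with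
  | zero => simp [pochC_zero]
  | succ l ih =>
    rw [sum_choose_succ_mul fun n _ => (-1) ^ n * pochC (c - b) n * (Complex.Gamma (c + n))⁻¹,
      ← sum_add_distrib, pochC_succ_left]
    have := ih (b + 1) (c + 1)
    push_cast
    rw [add_comm (l : ℂ) 1, ← add_assoc c, mul_assoc, ← this, mul_sum]
    refine sum_congr rfl fun n _ => ?_
    have hG := Complex.one_div_Gamma_eq_self_mul_one_div_Gamma_add_one (c + n)
    rw [pochC_succ, hG, add_sub_add_right_eq_sub, add_right_comm c 1, ← add_assoc c]
    ring

theorem sum_choose_mul_regHyp (a b c : ℂ) (l : ℕ) {t : ℂ} (ht : ‖t‖ < 1) :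
    ∑ n ∈ range (l + 1), (l.choose n : ℂ) * ((-1) ^ n * pochC (c - b) n) * regHyp a b (c + n) t =
      pochC b l * regHyp a (b + l) (c + l) t := by
  simp only [regHyp, ← tsum_mul_left]
  rw [← Summable.tsum_finsetSum fun (n : ℕ) _ =>
    (summable_regHypCoeff a b (c + n) ht).mul_left _]
  refine tsum_congr fun k => ?_
  have h := sum_choose_mul_pochC_mul_inv_Gamma (b + k) (c + k) l
  have hb : pochC b l * pochC (b + l) k = pochC b k * pochC (b + k) l := by
    rw [← pochC_add, ← pochC_add, add_comm]
  calc _ = pochC a k * pochC b k / (k.factorial : ℂ) * t ^ k * ∑ n ∈ range (l + 1),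
        (l.choose n : ℂ) *
          ((-1) ^ n * pochC (c + k - (b + k)) n * (Complex.Gamma (c + k + n))⁻¹) := by
        rw [mul_sum]
        refine sum_congr rfl fun n _ => ?_
        rw [add_sub_add_right_eq_sub, regHypCoeff, add_right_comm c (n : ℂ)]
        simp only [div_eq_mul_inv, mul_inv]
        ring
    _ = _ := by
        rw [h, regHypCoeff, add_right_comm c (l : ℂ)]
        simp only [div_eq_mul_inv, mul_inv]
        linear_combination -(pochC a k * (k.factorial : ℂ)⁻¹ * t ^ k *
          (Complex.Gamma (c + k + l))⁻¹) * hb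

theorem ferrersP_eq (ν μ : ℂ) (x : ℝ) :
    ferrersP ν μ x = (((1 + x) / (1 - x) : ℝ) : ℂ) ^ (μ / 2) *
      regHyp (-ν) (ν + 1) (1 - μ) (((1 - x) / 2 : ℝ) : ℂ) := by
  simp only [ferrersP, regHyp, regHypCoeff]
  congr! 7 with n
  ring

theorem stmt10 (ν : ℂ) (l : ℕ) (x : ℝ) (hx : -1 < x) (hx1 : x < 1) :
    ferrersP ν (-((l : ℂ) / 2)) x / Complex.Gamma (ν - (l : ℂ) / 2 + 1) =
      (2 : ℂ) ^ (-((l : ℂ) / 2)) * ((1 - x : ℝ) : ℂ) ^ ((l : ℂ) / 2) * (l.factorial : ℂ) /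
          Complex.Gamma (ν + (l : ℂ) / 2 + 1) *
        ∑ n ∈ Finset.range (l + 1),
          (-1 : ℂ) ^ n * pochC (-ν) n / ((n.factorial : ℂ) * ((l - n).factorial : ℂ)) *
            (((1 + x) / (1 - x) : ℝ) : ℂ) ^ ((n : ℂ) / 2) *
            ferrersP (ν - (l : ℂ) / 2) ((l : ℂ) / 2 - n) x := by
  set t : ℝ := (1 - x) / 2 with ht
  set w : ℝ := (1 + x) / (1 - x) with hw
  have ht0 : 0 < t := by rw [ht]; linarith
  have hw0 : 0 < w := div_pos (by linarith) (by linarith)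
  have hw' : (w : ℂ) ≠ 0 := by exact_mod_cast hw0.ne'
  have hwt : 1 - t = w * t := by
    have : 1 - x ≠ 0 := by linarith
    rw [ht, hw]
    field_simp
    ring
  have htn : ‖(t : ℂ)‖ < 1 := by
    rw [Complex.norm_real, Real.norm_of_nonneg ht0.le, ht]
    linarith
  set s : ℂ := (l : ℂ) / 2 with hs
  have hls : (l : ℂ) = s + s := by rw [hs]; ring
  have hpow : (2 : ℂ) ^ (-s) * ((1 - x : ℝ) : ℂ) ^ s = (t : ℂ) ^ s := by
    have : 1 - x = 2 * t := by rw [ht]; ring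
    rw [this, Complex.ofReal_mul, Complex.mul_cpow_ofReal_nonneg (by norm_num) ht0.le,
      ← mul_assoc, Complex.ofReal_ofNat, ← Complex.cpow_add _ _ two_ne_zero]
    simp
  have h1t : (1 - (t : ℂ)) ^ s = (w : ℂ) ^ s * (t : ℂ) ^ s := by
    rw [← Complex.mul_cpow_ofReal_nonneg hw0.le ht0.le, ← Complex.ofReal_mul, ← hwt]
    simp
  have hne : (1 - (t : ℂ)) ^ s ≠ 0 := by
    rw [h1t]
    have : (t : ℂ) ≠ 0 := by exact_mod_cast ht0.ne'
    simp [Complex.cpow_eq_zero_iff, hw', this]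
  have hE := regHyp_euler (-ν) (ν + 1) (1 + s) (fun n => by
    intro h
    have h := congrArg Complex.re h
    simp [hs] at h
    have : (0 : ℝ) ≤ l / 2 + n := by positivity
    linarith) htn
  rw [show 1 + s - -ν - (ν + 1) = s by ring] at hE
  have hV := sum_choose_mul_regHyp (s - ν) (ν - s + 1) (1 - s) l htn
  have hG := inv_Gamma_eq_pochC_mul (ν - s + 1) l
  rw [show ν - s + 1 + l = ν + s + 1 by rw [hls]; ring] at hG hV
  rw [show 1 - s + l = 1 + s by rw [hls]; ring] at hV
  have hcomm : regHyp (1 + s - -ν) (1 + s - (ν + 1)) (1 + s) t =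
      regHyp (s - ν) (ν + s + 1) (1 + s) t := by
    rw [show 1 + s - -ν = ν + s + 1 by ring, show 1 + s - (ν + 1) = s - ν by ring]
    simp only [regHyp, regHypCoeff, mul_comm (pochC (ν + s + 1) _)]
  have hR : ∑ n ∈ range (l + 1),
      (-1 : ℂ) ^ n * pochC (-ν) n / ((n.factorial : ℂ) * ((l - n).factorial : ℂ)) *
        (w : ℂ) ^ ((n : ℂ) / 2) * ferrersP (ν - s) (s - n) x =
      (w : ℂ) ^ (s / 2) * (l.factorial : ℂ)⁻¹ *
        (pochC (ν - s + 1) l * regHyp (s - ν) (ν + s + 1) (1 + s) t) := by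
    rw [← hV, mul_sum]
    refine sum_congr rfl fun n hn => ?_
    have hc : (l.choose n : ℂ) = l.factorial / ((n.factorial : ℂ) * ((l - n).factorial : ℂ)) :=
      Nat.cast_choose ℂ (Nat.lt_succ_iff.mp (mem_range.mp hn))
    have hl : (l.factorial : ℂ) ≠ 0 := by exact_mod_cast l.factorial_ne_zero
    have hww : (w : ℂ) ^ (s / 2) = (w : ℂ) ^ ((n : ℂ) / 2) * (w : ℂ) ^ ((s - n) / 2) := by
      rw [← Complex.cpow_add _ _ hw']
      ring_nf
    rw [ferrersP_eq, hc, ← hw, ← ht, hww, show -(ν - s) = s - ν by ring,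
      show 1 - s - (ν - s + 1) = -ν by ring, show 1 - (s - n) = 1 - s + n by ring]
    field_simp
  have hl : (l.factorial : ℂ) ≠ 0 := by exact_mod_cast l.factorial_ne_zero
  have hw2 : (w : ℂ) ^ s * (w : ℂ) ^ (-s / 2) = (w : ℂ) ^ (s / 2) := by
    rw [← Complex.cpow_add _ _ hw']
    ring_nf
  rw [hR, ← hcomm, ← hE, hpow, ferrersP_eq, ← hw, ← ht, div_eq_mul_inv, hG, h1t, sub_neg_eq_add,
    ← hw2]
  rw [h1t] at hne
  have hws := left_ne_zero_of_mul hne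
  have hts := right_ne_zero_of_mul hne
  field_simp
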